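/- arXiv:2309.13478 — 2 statements merged into one kernel-verified Lean document; each statement's English description precedes it below -/
import Mathlib

section
/- There exists a constant C > 0, depending only on d and D, such that for all symmetric d×d real matrices M_1, …, M_{D−d} with Λ = max_j ‖M_j‖ ≤ 1 and every 1 ≤ i ≤ D−d, one has | ∫_R (xᵀ M_i x) · S(x) dx − (π^{d/2} / ((d+2)·Γ(d/2+1))) · tr(M_i) | ≤ C Λ³. -/
open MeasureTheory Matrix Real

/-- First fundamental form of the graph of the quadratic embedding
`x ↦ (x, xᵀM₁x, …, xᵀM_{D-d}x)`. -/
noncomputable def gMat {d m : ℕ} (M : Fin m → Matrix (Fin d) (Fin d) ℝ)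
    (x : Fin d → ℝ) : Matrix (Fin d) (Fin d) ℝ :=
  1 + (4 : ℝ) • ∑ k, vecMulVec (M k *ᵥ x) (M k *ᵥ x)

/-- The density `S(x) = √(det g(x))`. -/
noncomputable def Sdens {d m : ℕ} (M : Fin m → Matrix (Fin d) (Fin d) ℝ)
    (x : Fin d → ℝ) : ℝ :=
  Real.sqrt (gMat M x).det

/-- The region `R = {x : ‖x‖² + Σⱼ Qⱼ(x)² ≤ 1}`, where `Qⱼ(x) = xᵀMⱼx`. -/
def regionR {d m : ℕ} (M : Fin m → Matrix (Fin d) (Fin d) ℝ) : Set (Fin d → ℝ) :=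
  {x | ∑ i, x i ^ 2 + ∑ j, (x ⬝ᵥ (M j *ᵥ x)) ^ 2 ≤ 1}

/-- `Λ`, the maximum of the operator norms of the matrices `M j`. -/
noncomputable def Lam {d m : ℕ} (M : Fin m → Matrix (Fin d) (Fin d) ℝ) : ℝ :=
  ⨆ j, ‖Matrix.toEuclideanCLM (𝕜 := ℝ) (M j)‖

/-- `A = Σⱼ tr(Mⱼ²)`. -/
noncomputable def Aconst {d m : ℕ} (M : Fin m → Matrix (Fin d) (Fin d) ℝ) : ℝ :=
  ∑ j, (M j * M j).trace

/-- `B = Σⱼ (tr Mⱼ)²`. -/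
noncomputable def Bconst {d m : ℕ} (M : Fin m → Matrix (Fin d) (Fin d) ℝ) : ℝ :=
  ∑ j, (M j).trace ^ 2


lemma abs_prod_sub_prod_le {ι : Type*} (s : Finset ι) (a b : ι → ℝ) {K ε : ℝ} (hK : 1 ≤ K)
    (ha : ∀ i, |a i| ≤ K) (hb : ∀ i, |b i| ≤ K) (hab : ∀ i, |a i - b i| ≤ ε) :
    |∏ i ∈ s, a i - ∏ i ∈ s, b i| ≤ s.card * K ^ s.card * ε := by
  classical
  induction s using Finset.induction_on with
  | empty => simp
  | insert j s hj ih =>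
    have hε : 0 ≤ ε := (abs_nonneg _).trans (hab j)
    have hprod : |∏ i ∈ s, b i| ≤ K ^ s.card := by
      rw [Finset.abs_prod]
      simpa using Finset.prod_le_prod (fun i _ => abs_nonneg (b i)) (fun i (_ : i ∈ s) => hb i)
    have hpow : (0 : ℝ) ≤ K ^ s.card := by positivity
    have h1 : |a j * (∏ i ∈ s, a i - ∏ i ∈ s, b i)| ≤ K * (s.card * K ^ s.card * ε) := by
      rw [abs_mul]
      exact mul_le_mul (ha j) ih (abs_nonneg _) (by linarith)
    have h2 : |(a j - b j) * ∏ i ∈ s, b i| ≤ K ^ s.card * ε := by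
      rw [abs_mul, mul_comm]
      exact mul_le_mul hprod (hab j) (abs_nonneg _) hpow
    have h3 : K ^ s.card * ε ≤ K * (K ^ s.card * ε) :=
      le_mul_of_one_le_left (mul_nonneg hpow hε) hK
    rw [Finset.prod_insert hj, Finset.prod_insert hj, Finset.card_insert_of_notMem hj]
    calc |a j * ∏ i ∈ s, a i - b j * ∏ i ∈ s, b i|
        = |a j * (∏ i ∈ s, a i - ∏ i ∈ s, b i) + (a j - b j) * ∏ i ∈ s, b i| := by ring_nf
      _ ≤ K * (s.card * K ^ s.card * ε) + K * (K ^ s.card * ε) :=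
          (abs_add_le _ _).trans (add_le_add h1 (h2.trans h3))
      _ = _ := by push_cast; ring

lemma abs_det_sub_det_le {d : ℕ} (A B : Matrix (Fin d) (Fin d) ℝ) {K ε : ℝ} (hK : 1 ≤ K)
    (hA : ∀ i j, |A i j| ≤ K) (hB : ∀ i j, |B i j| ≤ K) (hAB : ∀ i j, |A i j - B i j| ≤ ε) :
    |A.det - B.det| ≤ d.factorial * (d * K ^ d * ε) := by
  rw [Matrix.det_apply', Matrix.det_apply', ← Finset.sum_sub_distrib]
  refine (Finset.abs_sum_le_sum_abs _ _).trans ?_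
  refine (Finset.sum_le_card_nsmul _ _ (d * K ^ d * ε) fun σ _ => ?_).trans ?_
  · rw [← mul_sub, abs_mul]
    have hσ : |((Equiv.Perm.sign σ : ℤ) : ℝ)| = 1 := by
      rcases Int.units_eq_one_or (Equiv.Perm.sign σ) with h | h <;> simp [h]
    rw [hσ, one_mul]
    simpa using abs_prod_sub_prod_le Finset.univ (fun i => A (σ i) i) (fun i => B (σ i) i) hK
      (fun i => hA _ _) (fun i => hB _ _) (fun i => hAB _ _)
  · simp [Fintype.card_perm]

lemma abs_sqrt_sub_one_le (D : ℝ) : |√D - 1| ≤ |D - 1| := by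
  rcases le_total 0 D with h | h
  · have hs : D - 1 = (√D - 1) * (√D + 1) := by linear_combination -(Real.sq_sqrt h)
    rw [hs, abs_mul, abs_of_nonneg (by positivity : 0 ≤ √D + 1)]
    exact le_mul_of_one_le_right (abs_nonneg _) (by linarith [Real.sqrt_nonneg D])
  · rw [Real.sqrt_eq_zero'.2 h, abs_of_nonpos (by linarith : D - 1 ≤ 0)]
    norm_num
    linarith

lemma norm_toEuclideanCLM_le_Lam {d m : ℕ} (M : Fin m → Matrix (Fin d) (Fin d) ℝ) (j : Fin m) :
    ‖Matrix.toEuclideanCLM (𝕜 := ℝ) (M j)‖ ≤ Lam M :=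
  le_ciSup (f := fun j => ‖Matrix.toEuclideanCLM (𝕜 := ℝ) (M j)‖) (Set.finite_range _).bddAbove j

lemma Lam_nonneg {d m : ℕ} (M : Fin m → Matrix (Fin d) (Fin d) ℝ) : 0 ≤ Lam M :=
  Real.iSup_nonneg fun _ => norm_nonneg _

lemma norm_toLp_mulVec_le_Lam {d m : ℕ} (M : Fin m → Matrix (Fin d) (Fin d) ℝ) (j : Fin m)
    {x : EuclideanSpace ℝ (Fin d)} (hx : ‖x‖ ≤ 1) :
    ‖WithLp.toLp 2 (M j *ᵥ x.ofLp)‖ ≤ Lam M := by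
  have h := (Matrix.toEuclideanCLM (𝕜 := ℝ) (M j)).le_opNorm x
  have h' : Matrix.toEuclideanCLM (𝕜 := ℝ) (M j) x = WithLp.toLp 2 (M j *ᵥ x.ofLp) :=
    Matrix.toEuclideanCLM_toLp (M j) x.ofLp
  rw [h'] at h
  exact h.trans ((mul_le_of_le_one_right (norm_nonneg _) hx).trans
    (norm_toEuclideanCLM_le_Lam M j))

lemma abs_mulVec_apply_le_Lam {d m : ℕ} (M : Fin m → Matrix (Fin d) (Fin d) ℝ) (j : Fin m)
    {x : EuclideanSpace ℝ (Fin d)} (hx : ‖x‖ ≤ 1) (i : Fin d) :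
    |(M j *ᵥ x.ofLp) i| ≤ Lam M :=
  (PiLp.norm_apply_le (WithLp.toLp 2 (M j *ᵥ x.ofLp)) i).trans (norm_toLp_mulVec_le_Lam M j hx)

lemma abs_dotProduct_mulVec_le_Lam {d m : ℕ} (M : Fin m → Matrix (Fin d) (Fin d) ℝ) (j : Fin m)
    {x : EuclideanSpace ℝ (Fin d)} (hx : ‖x‖ ≤ 1) :
    |x.ofLp ⬝ᵥ (M j *ᵥ x.ofLp)| ≤ Lam M := by
  have h := abs_real_inner_le_norm (WithLp.toLp 2 (M j *ᵥ x.ofLp)) x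
  have h' : inner ℝ (WithLp.toLp 2 (M j *ᵥ x.ofLp)) x = x.ofLp ⬝ᵥ (M j *ᵥ x.ofLp) := by
    simpa using EuclideanSpace.inner_toLp_toLp (𝕜 := ℝ) (M j *ᵥ x.ofLp) x.ofLp
  rw [h'] at h
  exact h.trans ((mul_le_of_le_one_right (norm_nonneg _) hx).trans (norm_toLp_mulVec_le_Lam M j hx))

lemma abs_gMat_sub_one_le {d m : ℕ} (M : Fin m → Matrix (Fin d) (Fin d) ℝ)
    {x : EuclideanSpace ℝ (Fin d)} (hx : ‖x‖ ≤ 1) (i j : Fin d) :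
    |gMat M x.ofLp i j - (1 : Matrix (Fin d) (Fin d) ℝ) i j| ≤ 4 * m * Lam M ^ 2 := by
  have h : gMat M x.ofLp i j - (1 : Matrix (Fin d) (Fin d) ℝ) i j
      = 4 * ∑ k, (M k *ᵥ x.ofLp) i * (M k *ᵥ x.ofLp) j := by
    simp [gMat, Matrix.sum_apply, Matrix.vecMulVec_apply]
  rw [h, abs_mul, abs_of_pos (by norm_num : (0 : ℝ) < 4), mul_assoc]
  gcongr
  refine (Finset.abs_sum_le_sum_abs _ _).trans ?_
  refine (Finset.sum_le_card_nsmul _ _ (Lam M ^ 2) fun k _ => ?_).trans (by simp)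
  rw [abs_mul, sq]
  exact mul_le_mul (abs_mulVec_apply_le_Lam M k hx i) (abs_mulVec_apply_le_Lam M k hx j)
    (abs_nonneg _) (Lam_nonneg M)

lemma abs_Sdens_sub_one_le {d m : ℕ} (M : Fin m → Matrix (Fin d) (Fin d) ℝ) (hM : Lam M ≤ 1)
    {x : EuclideanSpace ℝ (Fin d)} (hx : ‖x‖ ≤ 1) :
    |Sdens M x.ofLp - 1| ≤ d.factorial * (d * (1 + 4 * m) ^ d * (4 * m * Lam M ^ 2)) := by
  have hone : ∀ i j, |(1 : Matrix (Fin d) (Fin d) ℝ) i j| ≤ 1 := fun i j => by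
    rw [Matrix.one_apply]; split_ifs <;> simp
  have hm : (0 : ℝ) ≤ 4 * m := by positivity
  have hL : Lam M ^ 2 ≤ 1 := pow_le_one₀ (Lam_nonneg M) hM
  have hdet := abs_det_sub_det_le (gMat M x.ofLp) 1 (K := 1 + 4 * m) (by linarith)
    (fun i j => ?_) (fun i j => (hone i j).trans (by linarith)) (abs_gMat_sub_one_le M hx)
  · rw [Matrix.det_one] at hdet
    exact (abs_sqrt_sub_one_le _).trans hdet
  · have h1 := abs_gMat_sub_one_le M hx i j
    have h2 := abs_add_le (gMat M x.ofLp i j - (1 : Matrix (Fin d) (Fin d) ℝ) i j)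
      ((1 : Matrix (Fin d) (Fin d) ℝ) i j)
    rw [sub_add_cancel] at h2
    have := mul_le_of_le_one_right hm hL
    linarith [hone i j]

lemma setIntegral_closedBall_comp_linearIsometryEquiv {d : ℕ}
    (e : EuclideanSpace ℝ (Fin d) ≃ₗᵢ[ℝ] EuclideanSpace ℝ (Fin d))
    (f : EuclideanSpace ℝ (Fin d) → ℝ) :
    ∫ x in Metric.closedBall 0 1, f (e x) = ∫ x in Metric.closedBall 0 1, f x := by
  have h := e.measurePreserving.setIntegral_preimage_emb
    e.toHomeomorph.measurableEmbedding f (Metric.closedBall 0 1)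
  rwa [e.preimage_closedBall, map_zero] at h

lemma setIntegral_closedBall_mul_eq_zero {d : ℕ} {i j : Fin d} (hij : i ≠ j) :
    ∫ x : EuclideanSpace ℝ (Fin d) in Metric.closedBall 0 1, x i * x j = 0 := by
  have h := setIntegral_closedBall_comp_linearIsometryEquiv
    (LinearIsometryEquiv.piLpCongrRight 2 (fun k : Fin d =>
      if k = i then LinearIsometryEquiv.neg ℝ else LinearIsometryEquiv.refl ℝ ℝ))
    (fun x => x i * x j)
  simp [hij.symm, integral_neg] at h
  linarith

lemma setIntegral_closedBall_sq_eq {d : ℕ} (i j : Fin d) :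
    ∫ x : EuclideanSpace ℝ (Fin d) in Metric.closedBall 0 1, x i ^ 2
      = ∫ x : EuclideanSpace ℝ (Fin d) in Metric.closedBall 0 1, x j ^ 2 := by
  have h := setIntegral_closedBall_comp_linearIsometryEquiv
    (LinearIsometryEquiv.piLpCongrLeft 2 ℝ ℝ (Equiv.swap i j)) (fun x => x j ^ 2)
  simpa [LinearIsometryEquiv.piLpCongrLeft_apply, Equiv.piCongrLeft'] using h

lemma setIntegral_closedBall_norm_sq {d : ℕ} (hd : 1 ≤ d) :
    ∫ x : EuclideanSpace ℝ (Fin d) in Metric.closedBall 0 1, ‖x‖ ^ 2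
      = d / (d + 2) * volume.real (Metric.closedBall (0 : EuclideanSpace ℝ (Fin d)) 1) := by
  have : NeZero d := ⟨by omega⟩
  have h := integral_fun_norm_addHaar (volume : Measure (EuclideanSpace ℝ (Fin d)))
    ((Set.Iic (1 : ℝ)).indicator fun r => r ^ 2)
  have h1 : (fun x : EuclideanSpace ℝ (Fin d) => (Set.Iic (1 : ℝ)).indicator (fun r => r ^ 2) ‖x‖)
      = (Metric.closedBall 0 1).indicator fun x => ‖x‖ ^ 2 := by
    ext x
    by_cases hx : ‖x‖ ≤ 1
    · rw [Set.indicator_of_mem (Set.mem_Iic.2 hx),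
        Set.indicator_of_mem (mem_closedBall_zero_iff.2 hx)]
    · rw [Set.indicator_of_notMem (mt Set.mem_Iic.1 hx),
        Set.indicator_of_notMem (mt mem_closedBall_zero_iff.1 hx)]
  have h2 : ∫ y in Set.Ioi (0 : ℝ), y ^ (d - 1) • (Set.Iic (1 : ℝ)).indicator (fun r => r ^ 2) y
      = 1 / (d + 2) := by
    have : (fun y : ℝ => y ^ (d - 1) • (Set.Iic (1 : ℝ)).indicator (fun r => r ^ 2) y)
        = (Set.Iic (1 : ℝ)).indicator fun y => y ^ (d + 1) := by
      ext y
      simp only [Set.indicator_apply, smul_eq_mul, mul_ite, mul_zero, ← pow_add]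
      congr 2
      omega
    rw [this, setIntegral_indicator measurableSet_Iic, Set.Ioi_inter_Iic,
      ← intervalIntegral.integral_of_le zero_le_one, integral_pow]
    push_cast
    norm_num [add_assoc]
  rw [h1, integral_indicator measurableSet_closedBall, finrank_euclideanSpace_fin, h2] at h
  rw [h, Measure.addHaar_real_closedBall volume _ zero_le_one, nsmul_eq_mul, smul_eq_mul]
  ring

lemma volume_real_closedBall_zero_one {d : ℕ} (hd : 1 ≤ d) :
    volume.real (Metric.closedBall (0 : EuclideanSpace ℝ (Fin d)) 1)
      = π ^ ((d : ℝ) / 2) / Real.Gamma ((d : ℝ) / 2 + 1) := by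
  have : NeZero d := ⟨by omega⟩
  have hΓ : 0 < Real.Gamma ((d : ℝ) / 2 + 1) := Real.Gamma_pos_of_pos (by positivity)
  rw [measureReal_def, EuclideanSpace.volume_closedBall, Fintype.card_fin, ENNReal.ofReal_one,
    one_pow, one_mul, ENNReal.toReal_ofReal (by positivity), Real.sqrt_eq_rpow,
    ← Real.rpow_natCast, ← Real.rpow_mul Real.pi_pos.le]
  ring_nf

lemma setIntegral_closedBall_coord_sq {d : ℕ} (i : Fin d) :
    ∫ x : EuclideanSpace ℝ (Fin d) in Metric.closedBall 0 1, x i ^ 2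
      = volume.real (Metric.closedBall (0 : EuclideanSpace ℝ (Fin d)) 1) / (d + 2) := by
  have hd : 1 ≤ d := i.pos
  have hd0 : (d : ℝ) ≠ 0 := by positivity
  have h := setIntegral_closedBall_norm_sq hd
  simp_rw [EuclideanSpace.real_norm_sq_eq] at h
  rw [integral_finsetSum] at h
  · simp_rw [setIntegral_closedBall_sq_eq _ i] at h
    rw [Finset.sum_const, Finset.card_univ, Fintype.card_fin, nsmul_eq_mul] at h
    apply mul_left_cancel₀ hd0
    rw [h]
    ring
  · intro j _
    exact (by fun_prop : Continuous fun x : EuclideanSpace ℝ (Fin d) => x j ^ 2).continuousOn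
      |>.integrableOn_compact (isCompact_closedBall 0 1)

lemma setIntegral_closedBall_dotProduct_mulVec {d : ℕ} (A : Matrix (Fin d) (Fin d) ℝ) :
    ∫ x : EuclideanSpace ℝ (Fin d) in Metric.closedBall 0 1, x.ofLp ⬝ᵥ (A *ᵥ x.ofLp)
      = volume.real (Metric.closedBall (0 : EuclideanSpace ℝ (Fin d)) 1) / (d + 2) * A.trace := by
  have hint : ∀ i j : Fin d, IntegrableOn
      (fun x : EuclideanSpace ℝ (Fin d) => A i j * (x i * x j)) (Metric.closedBall 0 1) :=
    fun i j => (by fun_prop : Continuous fun x : EuclideanSpace ℝ (Fin d) =>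
      A i j * (x i * x j)).continuousOn.integrableOn_compact (isCompact_closedBall 0 1)
  have hexp : ∀ x : EuclideanSpace ℝ (Fin d), x.ofLp ⬝ᵥ (A *ᵥ x.ofLp)
      = ∑ i, ∑ j, A i j * (x i * x j) := fun x => by
    simp only [dotProduct, mulVec, Finset.mul_sum]
    exact Finset.sum_congr rfl fun i _ => Finset.sum_congr rfl fun j _ => by ring
  simp_rw [hexp]
  rw [integral_finsetSum _ fun i _ => integrable_finsetSum _ fun j _ => hint i j, Matrix.trace,
    Finset.mul_sum]
  refine Finset.sum_congr rfl fun i _ => ?_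
  rw [integral_finsetSum _ fun j _ => hint i j, Finset.sum_eq_single i]
  · rw [integral_const_mul]
    simp_rw [← sq]
    rw [setIntegral_closedBall_coord_sq, Matrix.diag_apply]
    ring
  · intro j _ hji
    rw [integral_const_mul, setIntegral_closedBall_mul_eq_zero hji.symm, mul_zero]
  · simp

lemma continuous_Sdens {d m : ℕ} (M : Fin m → Matrix (Fin d) (Fin d) ℝ) :
    Continuous (Sdens M) := by
  unfold Sdens gMat
  fun_prop

lemma isClosed_regionR {d m : ℕ} (M : Fin m → Matrix (Fin d) (Fin d) ℝ) :
    IsClosed (regionR M) :=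
  isClosed_le (by fun_prop) continuous_const

lemma preimage_regionR_subset_closedBall {d m : ℕ} (M : Fin m → Matrix (Fin d) (Fin d) ℝ) :
    (WithLp.ofLp ⁻¹' regionR M : Set (EuclideanSpace ℝ (Fin d))) ⊆ Metric.closedBall 0 1 := by
  intro x hx
  have hx' : ∑ i, x i ^ 2 + ∑ j, (x.ofLp ⬝ᵥ (M j *ᵥ x.ofLp)) ^ 2 ≤ 1 := hx
  have hs : 0 ≤ ∑ j, (x.ofLp ⬝ᵥ (M j *ᵥ x.ofLp)) ^ 2 := Finset.sum_nonneg fun _ _ => sq_nonneg _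
  rw [mem_closedBall_zero_iff, ← sq_le_one_iff₀ (norm_nonneg x), EuclideanSpace.real_norm_sq_eq]
  linarith

lemma closedBall_subset_preimage_regionR {d m : ℕ} (M : Fin m → Matrix (Fin d) (Fin d) ℝ)
    (ht : m * Lam M ^ 2 ≤ 1) :
    Metric.closedBall 0 (1 - m * Lam M ^ 2) ⊆
      (WithLp.ofLp ⁻¹' regionR M : Set (EuclideanSpace ℝ (Fin d))) := by
  intro x hx
  rw [mem_closedBall_zero_iff] at hx
  have ht0 : 0 ≤ m * Lam M ^ 2 := by positivity
  have hx1 : ‖x‖ ≤ 1 := by linarith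
  have hs : ∑ j, (x.ofLp ⬝ᵥ (M j *ᵥ x.ofLp)) ^ 2 ≤ m * Lam M ^ 2 := by
    refine (Finset.sum_le_card_nsmul _ _ (Lam M ^ 2) fun k _ => ?_).trans (by simp)
    rw [← sq_abs]
    exact pow_le_pow_left₀ (abs_nonneg _) (abs_dotProduct_mulVec_le_Lam M k hx1) 2
  have hn : ‖x‖ ^ 2 ≤ 1 - m * Lam M ^ 2 := by nlinarith [norm_nonneg x]
  rw [EuclideanSpace.real_norm_sq_eq] at hn
  change ∑ i, x i ^ 2 + ∑ j, (x.ofLp ⬝ᵥ (M j *ᵥ x.ofLp)) ^ 2 ≤ 1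
  linarith

lemma volume_real_closedBall_sdiff_le {d m : ℕ} (hd : 1 ≤ d)
    (M : Fin m → Matrix (Fin d) (Fin d) ℝ) :
    volume.real (Metric.closedBall (0 : EuclideanSpace ℝ (Fin d)) 1 \ WithLp.ofLp ⁻¹' regionR M)
      ≤ d * (m * Lam M ^ 2) * volume.real (Metric.closedBall (0 : EuclideanSpace ℝ (Fin d)) 1) := by
  have hfin : volume (Metric.closedBall (0 : EuclideanSpace ℝ (Fin d)) 1) ≠ ⊤ :=
    measure_closedBall_lt_top.ne
  have ht0 : 0 ≤ m * Lam M ^ 2 := by positivity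
  have hd1 : (1 : ℝ) ≤ d := by exact_mod_cast hd
  rcases le_total (m * Lam M ^ 2) 1 with ht | ht
  · have hsub : Metric.closedBall (0 : EuclideanSpace ℝ (Fin d)) (1 - m * Lam M ^ 2)
        ⊆ Metric.closedBall 0 1 := Metric.closedBall_subset_closedBall (by linarith)
    refine (measureReal_mono (Set.sdiff_subset_sdiff_right (closedBall_subset_preimage_regionR M ht))
      (measure_ne_top_of_subset Set.sdiff_subset hfin)).trans ?_
    rw [measureReal_sdiff hsub measurableSet_closedBall,
      Measure.addHaar_real_closedBall' volume _ (by linarith : 0 ≤ 1 - m * Lam M ^ 2),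
      finrank_euclideanSpace_fin]
    have hb := one_add_mul_le_pow (by linarith : -2 ≤ -(m * Lam M ^ 2)) d
    rw [← sub_eq_add_neg] at hb
    nlinarith [mul_le_mul_of_nonneg_right hb
      (measureReal_nonneg (μ := volume) (s := Metric.closedBall (0 : EuclideanSpace ℝ (Fin d)) 1))]
  · refine (measureReal_mono Set.sdiff_subset hfin).trans
      (le_mul_of_one_le_left measureReal_nonneg ?_)
    nlinarith

theorem stmt11 (d D : ℕ) (hd : 1 ≤ d) (hD : d < D) :
    ∃ C > 0, ∀ M : Fin (D - d) → Matrix (Fin d) (Fin d) ℝ,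
      (∀ j, (M j).IsSymm) → Lam M ≤ 1 →
      ∀ i : Fin (D - d),
        |(∫ x in regionR M, (x ⬝ᵥ (M i *ᵥ x)) * Sdens M x) -
            Real.pi ^ ((d : ℝ) / 2) / (((d : ℝ) + 2) * Real.Gamma ((d : ℝ) / 2 + 1)) *
              (M i).trace|
          ≤ C * Lam M ^ 3 := by
  set m := D - d
  set ω := volume.real (Metric.closedBall (0 : EuclideanSpace ℝ (Fin d)) 1)
  set K : ℝ := d.factorial * (d * (1 + 4 * m) ^ d * (4 * m))
  have hω0 : 0 ≤ ω := measureReal_nonneg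
  have hK0 : 0 ≤ K := by positivity
  refine ⟨K * ω + d * m * ω + 1, by positivity, fun M _ hM i => ?_⟩
  have hL := Lam_nonneg M
  set R : Set (EuclideanSpace ℝ (Fin d)) := WithLp.ofLp ⁻¹' regionR M
  set B : Set (EuclideanSpace ℝ (Fin d)) := Metric.closedBall 0 1
  have hRB : R ⊆ B := preimage_regionR_subset_closedBall M
  have hRc : IsClosed R := (isClosed_regionR M).preimage (PiLp.continuous_ofLp 2 _)
  have hBfin : volume B < ⊤ := measure_closedBall_lt_top
  let q : EuclideanSpace ℝ (Fin d) → ℝ := fun x => x.ofLp ⬝ᵥ (M i *ᵥ x.ofLp)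
  let S : EuclideanSpace ℝ (Fin d) → ℝ := fun x => Sdens M x.ofLp
  have hq : Continuous q := by fun_prop
  have hS : Continuous S := (continuous_Sdens M).comp (PiLp.continuous_ofLp 2 _)
  have hRk : IsCompact R := (isCompact_closedBall _ _).of_isClosed_subset hRc hRB
  have htransfer : ∫ x in regionR M, (x ⬝ᵥ (M i *ᵥ x)) * Sdens M x = ∫ x in R, q x * S x :=
    ((PiLp.volume_preserving_ofLp (Fin d)).setIntegral_preimage_emb
      (MeasurableEquiv.toLp 2 (Fin d → ℝ)).symm.measurableEmbedding
      (fun x => (x ⬝ᵥ (M i *ᵥ x)) * Sdens M x) (regionR M)).symm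
  have hmain : π ^ ((d : ℝ) / 2) / (((d : ℝ) + 2) * Real.Gamma ((d : ℝ) / 2 + 1)) * (M i).trace
      = ∫ x in B, q x := by
    rw [setIntegral_closedBall_dotProduct_mulVec, volume_real_closedBall_zero_one hd]
    rw [div_div, mul_comm ((d : ℝ) + 2)]
  have hdiff : ∫ x in B \ R, q x = (∫ x in B, q x) - ∫ x in R, q x :=
    setIntegral_sdiff hRc.measurableSet
      (hq.continuousOn.integrableOn_compact (isCompact_closedBall _ _)) hRB
  have hsub : ∫ x in R, q x * (S x - 1) = (∫ x in R, q x * S x) - ∫ x in R, q x := by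
    have hqS : IntegrableOn (fun x => q x * S x) R :=
      (hq.mul hS).continuousOn.integrableOn_compact hRk
    rw [← integral_sub hqS (hq.continuousOn.integrableOn_compact hRk)]
    simp only [mul_sub, mul_one]
  have hnear : |∫ x in R, q x * (S x - 1)| ≤ K * ω * Lam M ^ 3 := by
    have h := norm_setIntegral_le_of_norm_le_const (μ := volume) (s := R)
      (f := fun x => q x * (S x - 1)) (C := Lam M * (K * Lam M ^ 2))
      ((measure_mono hRB).trans_lt hBfin) fun x hx => by
        have hx1 : ‖x‖ ≤ 1 := mem_closedBall_zero_iff.1 (hRB hx)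
        rw [norm_mul]
        refine mul_le_mul (abs_dotProduct_mulVec_le_Lam M i hx1) ?_ (norm_nonneg _) hL
        refine (abs_Sdens_sub_one_le M hM hx1).trans (le_of_eq ?_)
        ring
    refine h.trans ?_
    calc Lam M * (K * Lam M ^ 2) * volume.real R ≤ Lam M * (K * Lam M ^ 2) * ω := by
          gcongr
          exact measureReal_mono hRB hBfin.ne
      _ = K * ω * Lam M ^ 3 := by ring
  have hfar : |∫ x in B \ R, q x| ≤ d * m * ω * Lam M ^ 3 := by
    have h := norm_setIntegral_le_of_norm_le_const (μ := volume) (s := B \ R)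
      (f := q) (C := Lam M) ((measure_mono Set.sdiff_subset).trans_lt hBfin) fun x hx =>
        abs_dotProduct_mulVec_le_Lam M i (mem_closedBall_zero_iff.1 hx.1)
    refine h.trans ?_
    calc Lam M * volume.real (B \ R) ≤ Lam M * (d * (m * Lam M ^ 2) * ω) := by
          gcongr
          exact volume_real_closedBall_sdiff_le hd M
      _ = d * m * ω * Lam M ^ 3 := by ring
  rw [htransfer, hmain]
  calc |(∫ x in R, q x * S x) - ∫ x in B, q x|
      = |(∫ x in R, q x * (S x - 1)) - ∫ x in B \ R, q x| := by
        rw [hsub, hdiff]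
        ring_nf
    _ ≤ K * ω * Lam M ^ 3 + d * m * ω * Lam M ^ 3 :=
        (abs_sub _ _).trans (add_le_add hnear hfar)
    _ ≤ (K * ω + d * m * ω + 1) * Lam M ^ 3 := by
        have := pow_nonneg hL 3
        linarith
end

section
/- There exists a constant C > 0, depending only on d and D, such that for all symmetric d×d real matrices M_1, …, M_{D−d} with Λ = max_j ‖M_j‖ ≤ 1, one has | Σ_{i=1}^d ∫_R x_i² S(x) dx − (π^{d/2}/Γ(d/2)) · ( 2/(d+2) − B/(d(d+2)) + 2A/((d+2)(d+4)) ) | ≤ C Λ⁴. -/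
open MeasureTheory Matrix Real

theorem exp_le_one_add_add_sq_mul_exp {x : ℝ} (hx : 0 ≤ x) : exp x ≤ 1 + x + x ^ 2 * exp x := by
  have h : exp x - 1 ≤ x * exp x := by
    have := mul_le_mul_of_nonneg_right (one_sub_le_exp_neg x) (exp_pos x).le
    rw [← exp_add, neg_add_cancel, exp_zero] at this
    linarith
  nlinarith [add_one_le_exp x]

theorem abs_sqrt_sub_one_sub_le {p K D : ℝ} (hp : 0 ≤ p) (hK : p ≤ K) (h1 : 1 + 4 * p ≤ D)
    (h2 : D ≤ exp (4 * p)) : |√D - (1 + 2 * p)| ≤ 4 * exp (2 * K) * p ^ 2 := by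
  have hK' : exp (2 * p) ≤ exp (2 * K) := exp_le_exp.2 (by linarith)
  have h1K : 1 ≤ exp (2 * K) := one_le_exp (by linarith)
  rw [abs_le]
  constructor
  · have : 1 + 2 * p - 2 * p ^ 2 ≤ √D := by
      rcases le_or_gt p 2 with h | h
      · apply le_sqrt_of_sq_le
        nlinarith [mul_nonneg (pow_nonneg hp 3) (sub_nonneg.2 h)]
      · nlinarith [sqrt_nonneg D]
    nlinarith [sq_nonneg p]
  · have h3 : √D ≤ exp (2 * p) := by
      rw [sqrt_le_left (exp_pos _).le, ← exp_nat_mul]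
      convert h2 using 2
      push_cast; ring
    nlinarith [exp_le_one_add_add_sq_mul_exp (x := 2 * p) (by linarith), sq_nonneg p]

theorem one_add_sum_le_prod_one_add {ι : Type*} (s : Finset ι) {f : ι → ℝ} (hf : ∀ i, 0 ≤ f i) :
    1 + ∑ i ∈ s, f i ≤ ∏ i ∈ s, (1 + f i) := by
  classical
  induction s using Finset.induction_on with
  | empty => simp
  | insert a s ha ih =>
    rw [Finset.sum_insert ha, Finset.prod_insert ha]
    nlinarith [hf a, mul_le_mul_of_nonneg_left ih (hf a),
      mul_nonneg (hf a) (Finset.sum_nonneg fun i (_ : i ∈ s) => hf i)]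

theorem Matrix.PosSemidef.det_one_add_bounds {n : Type*} [Fintype n] [DecidableEq n]
    {P : Matrix n n ℝ} (hP : P.PosSemidef) :
    1 + P.trace ≤ (1 + P).det ∧ (1 + P).det ≤ exp P.trace := by
  have hdet : (1 + P).det = ∏ i, (1 + hP.1.eigenvalues i) := by
    have h := congrArg (Polynomial.eval (-1)) hP.1.charpoly_eq
    rw [Matrix.eval_charpoly, Polynomial.eval_prod] at h
    have h2 : (scalar n (-1 : ℝ) - P) = -(1 + P) := by
      rw [map_neg, map_one]; abel
    rw [h2, det_neg] at h
    have h3 : ∀ i, Polynomial.eval (-1) (Polynomial.X - Polynomial.C ((hP.1.eigenvalues i : ℝ) : ℝ))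
        = (-1) * (1 + hP.1.eigenvalues i) := by
      intro i; simp; ring
    simp only [RCLike.ofReal_real_eq_id, id] at h
    rw [Finset.prod_congr rfl (fun i _ => h3 i), Finset.prod_mul_distrib, Finset.prod_const,
      Finset.card_univ] at h
    exact mul_left_cancel₀ (pow_ne_zero _ (by norm_num)) h
  have htr : P.trace = ∑ i, hP.1.eigenvalues i := by
    simpa using hP.1.trace_eq_sum_eigenvalues
  rw [hdet, htr]
  exact ⟨one_add_sum_le_prod_one_add _ hP.eigenvalues_nonneg,
    prod_one_add_le_exp_sum _ fun i => hP.eigenvalues_nonneg i⟩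

/-- Second order expansion of powers of the positive root of `s² + q s⁴ = 1`. -/
theorem abs_pow_sub_le_of_sq_add {s q : ℝ} (hs : 0 < s) (hq : 0 ≤ q) (h : s ^ 2 + s ^ 4 * q = 1)
    (n : ℕ) : |s ^ n - (1 - n / 2 * q)| ≤ (n ^ 2 + 3 * n) * q ^ 2 := by
  have hs1 : s ≤ 1 := by
    have : 0 ≤ s ^ 4 * q := by positivity
    nlinarith
  have hs4 : s ^ 4 ≤ 1 := pow_le_one₀ hs.le hs1
  have h1 : 1 - s ≤ q := by nlinarith
  have hpow : ∀ n : ℕ, 0 ≤ s ^ n - 1 + n * (1 - s) ∧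
      s ^ n - 1 + n * (1 - s) ≤ n ^ 2 * (1 - s) ^ 2 := by
    intro n
    induction n with
    | zero => simp
    | succ k ih =>
      have e : s ^ (k + 1) - 1 + ((k + 1 : ℕ) : ℝ) * (1 - s)
          = s * (s ^ k - 1 + k * (1 - s)) + k * (1 - s) ^ 2 := by push_cast; ring
      have hk : (0 : ℝ) ≤ k * (1 - s) ^ 2 := by positivity
      rw [e]
      push_cast
      constructor
      · have := mul_nonneg hs.le ih.1
        linarith
      · nlinarith [mul_le_mul_of_nonneg_right hs1 ih.1, sq_nonneg (1 - s)]
  have hu : |(1 - s) - q / 2| ≤ 3 * q ^ 2 := by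
    have e : (1 - s) - q / 2 = (1 - s) ^ 2 / 2 - q * (1 - s ^ 4) / 2 := by nlinarith
    have e2 : 1 - s ^ 4 ≤ 2 * q := by nlinarith
    have e3 : (1 - s) ^ 2 ≤ q ^ 2 := by nlinarith
    rw [e, abs_le]
    constructor
    · nlinarith [mul_le_mul_of_nonneg_left e2 hq, sq_nonneg (1 - s)]
    · nlinarith [mul_nonneg hq (sub_nonneg.2 hs4)]
  obtain ⟨ha, hb⟩ := hpow n
  have hc : (n : ℝ) ^ 2 * (1 - s) ^ 2 ≤ n ^ 2 * q ^ 2 := by gcongr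
  have hn : (0 : ℝ) ≤ n := n.cast_nonneg
  rw [abs_le] at hu ⊢
  constructor <;> nlinarith [mul_le_mul_of_nonneg_left hu.1 hn,
    mul_le_mul_of_nonneg_left hu.2 hn, mul_nonneg (sq_nonneg (n : ℝ)) (sq_nonneg q)]

theorem exists_pos_sq_add_eq_one {q : ℝ} (hq : 0 ≤ q) :
    ∃ s : ℝ, 0 < s ∧ s ^ 2 + s ^ 4 * q = 1 := by
  have hc : ContinuousOn (fun s : ℝ => s ^ 2 + s ^ 4 * q) (Set.Icc 0 1) := by fun_prop
  obtain ⟨s, hs, he⟩ := intermediate_value_Icc zero_le_one hc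
    (show (1 : ℝ) ∈ Set.Icc _ _ by constructor <;> norm_num; positivity)
  refine ⟨s, lt_of_le_of_ne hs.1 ?_, he⟩
  rintro rfl
  simp at he

theorem integral_Ioi_indicator_pow {s q : ℝ} (hs : 0 < s) (hq : 0 ≤ q) (h : s ^ 2 + s ^ 4 * q = 1)
    (n : ℕ) (p : ℝ) :
    ∫ r in Set.Ioi (0 : ℝ), r ^ n *
      ({r : ℝ | r ^ 2 + r ^ 4 * q ≤ 1}.indicator (fun r => r ^ 2 * (1 + 2 * (r ^ 2 * p))) r) =
      s ^ (n + 3) / (n + 3) + 2 * p * (s ^ (n + 5) / (n + 5)) := by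
  have hmem : ∀ r : ℝ, 0 < r → (r ^ 2 + r ^ 4 * q ≤ 1 ↔ r ≤ s) := by
    intro r hr
    constructor
    · intro h'
      by_contra! hlt
      have : s ^ 2 < r ^ 2 := by gcongr
      have : s ^ 4 * q ≤ r ^ 4 * q := by gcongr
      linarith
    · intro h'
      rw [← h]
      gcongr
  have e : ∀ r ∈ Set.Ioi (0 : ℝ), r ^ n *
      ({r : ℝ | r ^ 2 + r ^ 4 * q ≤ 1}.indicator (fun r => r ^ 2 * (1 + 2 * (r ^ 2 * p))) r) =
      (Set.Iic s).indicator (fun r => r ^ (n + 2) + 2 * p * r ^ (n + 4)) r := by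
    intro r hr
    by_cases hrs : r ≤ s
    · rw [Set.indicator_of_mem (show r ∈ {r : ℝ | r ^ 2 + r ^ 4 * q ≤ 1} from (hmem r hr).2 hrs),
        Set.indicator_of_mem (show r ∈ Set.Iic s from hrs)]
      ring
    · rw [Set.indicator_of_notMem (show r ∉ {r : ℝ | r ^ 2 + r ^ 4 * q ≤ 1} from
          fun h' => hrs ((hmem r hr).1 h')),
        Set.indicator_of_notMem (show r ∉ Set.Iic s from hrs), mul_zero]
  rw [setIntegral_congr_fun measurableSet_Ioi e, setIntegral_indicator measurableSet_Iic,
    Set.Ioi_inter_Iic, ← intervalIntegral.integral_of_le hs.le, intervalIntegral.integral_add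
      (by apply Continuous.intervalIntegrable; fun_prop)
      (by apply Continuous.intervalIntegrable; fun_prop),
    intervalIntegral.integral_const_mul, integral_pow, integral_pow]
  norm_num [add_assoc]

section Polar
variable {E : Type*} [NormedAddCommGroup E] [NormedSpace ℝ E] [MeasurableSpace E] [BorelSpace E]
  [FiniteDimensional ℝ E] (μ : Measure E) [μ.IsAddHaarMeasure]

theorem integral_volumeIoiPow (n : ℕ) (g : ℝ → ℝ) :
    ∫ r : Set.Ioi (0 : ℝ), g r ∂(Measure.volumeIoiPow n) = ∫ r in Set.Ioi (0 : ℝ), r ^ n * g r := by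
  simp only [Measure.volumeIoiPow, ENNReal.ofReal]
  rw [integral_withDensity_eq_integral_smul,
    integral_subtype_comap measurableSet_Ioi fun a ↦ Real.toNNReal (a ^ n) • g a]
  · refine setIntegral_congr_fun measurableSet_Ioi fun x hx ↦ ?_
    rw [NNReal.smul_def, Real.coe_toNNReal _ (pow_nonneg (le_of_lt hx) _), smul_eq_mul]
  · exact (measurable_subtype_coe.pow_const _).real_toNNReal

theorem integrable_sphere_prod {f : E → ℝ} (hf : Integrable f μ) :
    Integrable (fun z : Metric.sphere (0 : E) 1 × Set.Ioi (0 : ℝ) => f ((z.2 : ℝ) • (z.1 : E)))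
      (μ.toSphere.prod (Measure.volumeIoiPow (Module.finrank ℝ E - 1))) := by
  rw [← μ.measurePreserving_homeomorphUnitSphereProd.integrable_comp_emb
    (Homeomorph.measurableEmbedding _)]
  have h : Integrable (fun x : ({(0)}ᶜ : Set E) => f x) (μ.comap (↑)) :=
    (integrableOn_iff_comap_subtypeVal (measurableSet_singleton _).compl).1 hf.integrableOn
  refine h.congr (.of_forall fun x => ?_)
  have : (x : E) ≠ 0 := x.2
  simp [smul_smul, this]

variable [Nontrivial E]

theorem integral_eq_integral_sphere_prod (f : E → ℝ) :
    ∫ x, f x ∂μ = ∫ z, f ((z.2 : ℝ) • (z.1 : E))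
      ∂(μ.toSphere.prod (Measure.volumeIoiPow (Module.finrank ℝ E - 1))) := by
  calc
    ∫ x, f x ∂μ = ∫ x : ({(0)}ᶜ : Set E), f x ∂(μ.comap (↑)) := by
      rw [integral_subtype_comap (measurableSet_singleton _).compl fun x ↦ f x,
        restrict_compl_singleton]
    _ = _ := by
      rw [← μ.measurePreserving_homeomorphUnitSphereProd.integral_comp
        (Homeomorph.measurableEmbedding _)]
      refine integral_congr_ae (.of_forall fun x => ?_)
      have : (x : E) ≠ 0 := x.2
      simp [smul_smul, this]

theorem integral_polar {f : E → ℝ} (hf : Integrable f μ) :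
    Integrable (fun ω : Metric.sphere (0 : E) 1 =>
        ∫ r in Set.Ioi (0 : ℝ), r ^ (Module.finrank ℝ E - 1) * f (r • (ω : E))) μ.toSphere ∧
    ∫ x, f x ∂μ = ∫ ω, (∫ r in Set.Ioi (0 : ℝ), r ^ (Module.finrank ℝ E - 1) * f (r • (ω : E)))
      ∂μ.toSphere := by
  have h := integrable_sphere_prod μ hf
  have e : ∀ ω : Metric.sphere (0 : E) 1,
      ∫ r : Set.Ioi (0 : ℝ), f ((r : ℝ) • (ω : E))
        ∂(Measure.volumeIoiPow (Module.finrank ℝ E - 1)) =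
      ∫ r in Set.Ioi (0 : ℝ), r ^ (Module.finrank ℝ E - 1) * f (r • (ω : E)) :=
    fun ω => integral_volumeIoiPow _ fun r => f (r • (ω : E))
  refine ⟨?_, ?_⟩
  · simpa only [e] using h.integral_prod_left
  · rw [integral_eq_integral_sphere_prod, integral_prod _ h]
    simp only [e]

theorem integral_homogeneous_mul (h : E → ℝ) (k : ℕ) (g : ℝ → ℝ)
    (hh : ∀ (r : ℝ) (x : E), h (r • x) = r ^ k * h x) :
    ∫ x, h x * g ‖x‖ ∂μ = (∫ ω : Metric.sphere (0 : E) 1, h ω ∂μ.toSphere) *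
      ∫ r in Set.Ioi (0 : ℝ), r ^ (Module.finrank ℝ E - 1) * (r ^ k * g r) := by
  rw [integral_eq_integral_sphere_prod, ← integral_volumeIoiPow, ← integral_prod_mul]
  refine integral_congr_ae (.of_forall fun z => ?_)
  have : ‖(z.1 : E)‖ = 1 := by simp
  have h2 : (0 : ℝ) < z.2 := z.2.2
  simp only [hh, norm_smul, this, norm_of_nonneg h2.le]
  ring_nf

theorem integral_Ioi_pow_mul_exp_neg_sq (n : ℕ) :
    ∫ r in Set.Ioi (0 : ℝ), r ^ n * exp (-r ^ 2) = Gamma ((n + 1) / 2) / 2 := by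
  have := integral_rpow_mul_exp_neg_rpow (p := 2) (q := n) two_pos
    (by linarith [n.cast_nonneg (α := ℝ)])
  simp only [rpow_natCast, rpow_two] at this
  rw [this]; ring

theorem integral_pow_two_mul_exp_neg_sq (n : ℕ) :
    ∫ x : ℝ, x ^ (2 * n) * exp (-x ^ 2) = Gamma (n + 1 / 2) := by
  have := integral_comp_abs (f := fun x : ℝ => x ^ (2 * n) * exp (-x ^ 2))
  simp only [pow_mul, sq_abs] at this
  simp only [pow_mul]
  rw [this]
  simp only [← pow_mul]
  rw [integral_Ioi_pow_mul_exp_neg_sq]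
  push_cast
  ring_nf

theorem integrable_pow_two_mul_exp_neg_sq (n : ℕ) :
    Integrable fun x : ℝ => x ^ (2 * n) * exp (-x ^ 2) := by
  have := integrable_rpow_mul_exp_neg_mul_sq one_pos (s := (2 * n : ℕ))
    (by linarith [(2 * n).cast_nonneg (α := ℝ)])
  simpa only [rpow_natCast, neg_mul, one_mul] using this

end Polar

section Gaussian
variable {d : ℕ}

theorem Gamma_half : Gamma (((0 : ℕ) : ℝ) + 1 / 2) = √π ∧
    Gamma (((1 : ℕ) : ℝ) + 1 / 2) = √π * (1 / 2) ∧
    Gamma (((2 : ℕ) : ℝ) + 1 / 2) = √π * (3 / 4) := by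
  have h0 : Gamma (((0 : ℕ) : ℝ) + 1 / 2) = √π := by simpa using Gamma_one_half_eq
  have h1 : Gamma (((1 : ℕ) : ℝ) + 1 / 2) = √π * (1 / 2) := by
    rw [show ((1 : ℕ) : ℝ) + 1 / 2 = 1 / 2 + 1 by norm_num, Gamma_add_one (by norm_num),
      Gamma_one_half_eq]; ring
  refine ⟨h0, h1, ?_⟩
  rw [show ((2 : ℕ) : ℝ) + 1 / 2 = (((1 : ℕ) : ℝ) + 1 / 2) + 1 by norm_num,
    Gamma_add_one (by norm_num), h1]; norm_num; ring

theorem monomial_mul_exp_neg_norm_sq (a : Fin d → ℕ) (x : Fin d → ℝ) :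
    (∏ i, x i ^ (2 * a i)) * exp (-‖WithLp.toLp 2 x‖ ^ 2) =
      ∏ i, (x i ^ (2 * a i) * exp (-x i ^ 2)) := by
  rw [Finset.prod_mul_distrib, ← exp_sum, EuclideanSpace.real_norm_sq_eq, Finset.sum_neg_distrib]

theorem integrable_gaussian_monomial (a : Fin d → ℕ) :
    Integrable fun x : EuclideanSpace ℝ (Fin d) => (∏ i, x i ^ (2 * a i)) * exp (-‖x‖ ^ 2) := by
  rw [← (PiLp.volume_preserving_toLp (Fin d)).integrable_comp_emb
    (MeasurableEquiv.toLp 2 _).measurableEmbedding]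
  simp only [Function.comp_def, monomial_mul_exp_neg_norm_sq]
  exact Integrable.fintype_prod fun i => integrable_pow_two_mul_exp_neg_sq (a i)

theorem integral_gaussian_monomial (a : Fin d → ℕ) :
    ∫ x : EuclideanSpace ℝ (Fin d), (∏ i, x i ^ (2 * a i)) * exp (-‖x‖ ^ 2) =
      ∏ i, Gamma (a i + 1 / 2) := by
  rw [← (PiLp.volume_preserving_toLp (Fin d)).integral_comp
    (MeasurableEquiv.toLp 2 _).measurableEmbedding]
  simp only [monomial_mul_exp_neg_norm_sq]
  rw [integral_fintype_prod_volume_eq_prod (fun i t => t ^ (2 * a i) * exp (-t ^ 2))]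
  simp only [integral_pow_two_mul_exp_neg_sq]

theorem integral_exp_neg_norm_sq : ∫ x : EuclideanSpace ℝ (Fin d), exp (-‖x‖ ^ 2) = √π ^ d := by
  
  have h := integral_gaussian_monomial (0 : Fin d → ℕ)
  simp only [Pi.zero_apply, Gamma_half.1] at h
  simpa using h

theorem gaussian_sq (i : Fin d) :
    Integrable (fun x : EuclideanSpace ℝ (Fin d) => x i ^ 2 * exp (-‖x‖ ^ 2)) ∧
    ∫ x : EuclideanSpace ℝ (Fin d), x i ^ 2 * exp (-‖x‖ ^ 2) = √π ^ d * (1 / 2) := by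
  have e : ∀ x : EuclideanSpace ℝ (Fin d),
      x i ^ 2 = ∏ k, x k ^ (2 * (Pi.single i 1 : Fin d → ℕ) k) := by
    intro x
    rw [Finset.prod_eq_single i (fun k _ hk => by simp [hk]) (by simp)]
    simp
  simp only [e]
  refine ⟨integrable_gaussian_monomial _, ?_⟩
  have h : ∀ k, Gamma ((Pi.single i 1 : Fin d → ℕ) k + 1 / 2) =
      √π * (if k = i then 1 / 2 else 1) := by
    intro k
    by_cases hk : k = i
    · subst hk; rw [Pi.single_eq_same, if_pos rfl, Gamma_half.2.1]
    · rw [Pi.single_eq_of_ne hk, if_neg hk, Gamma_half.1, mul_one]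
  rw [integral_gaussian_monomial]
  simp only [h, Finset.prod_mul_distrib, Finset.prod_const, Finset.prod_ite_eq']
  simp

theorem gaussian_sq_mul_sq (i j : Fin d) :
    Integrable (fun x : EuclideanSpace ℝ (Fin d) => (x i ^ 2 * x j ^ 2) * exp (-‖x‖ ^ 2)) ∧
    ∫ x : EuclideanSpace ℝ (Fin d), (x i ^ 2 * x j ^ 2) * exp (-‖x‖ ^ 2) =
      √π ^ d * (1 / 4 + if i = j then 1 / 2 else 0) := by
  have e : ∀ (x : EuclideanSpace ℝ (Fin d)) (l : Fin d),
      x l ^ 2 = ∏ k, x k ^ (2 * (Pi.single l 1 : Fin d → ℕ) k) := by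
    intro x l
    rw [Finset.prod_eq_single l (fun k _ hk => by simp [hk]) (by simp)]
    simp
  have e2 : ∀ x : EuclideanSpace ℝ (Fin d), x i ^ 2 * x j ^ 2 =
      ∏ k, x k ^ (2 * (Pi.single i 1 + Pi.single j 1 : Fin d → ℕ) k) := by
    intro x
    simp only [e x i, e x j, ← Finset.prod_mul_distrib, ← pow_add, ← mul_add, Pi.add_apply]
  simp only [e2]
  refine ⟨integrable_gaussian_monomial _, ?_⟩
  rw [integral_gaussian_monomial]
  by_cases hij : i = j
  · subst hij
    have h : ∀ k, Gamma (((Pi.single i 1 + Pi.single i 1 : Fin d → ℕ) k : ℕ) + 1 / 2)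
        = √π * (if k = i then 3 / 4 else 1) := by
      intro k
      by_cases hk : k = i
      · subst hk; rw [Pi.add_apply, Pi.single_eq_same, if_pos rfl, Gamma_half.2.2]
      · rw [Pi.add_apply, Pi.single_eq_of_ne hk, if_neg hk, add_zero, Gamma_half.1, mul_one]
    simp only [h, Finset.prod_mul_distrib, Finset.prod_const, Finset.prod_ite_eq']
    norm_num
  · have h : ∀ k, Gamma (((Pi.single i 1 + Pi.single j 1 : Fin d → ℕ) k : ℕ) + 1 / 2)
        = √π * ((if k = i then 1 / 2 else 1) * (if k = j then 1 / 2 else 1)) := by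
      intro k
      by_cases hk : k = i
      · subst hk
        rw [Pi.add_apply, Pi.single_eq_same, Pi.single_eq_of_ne hij, if_pos rfl, if_neg hij,
          add_zero, Gamma_half.2.1, mul_one]
      · by_cases hkj : k = j
        · subst hkj
          rw [Pi.add_apply, Pi.single_eq_same, Pi.single_eq_of_ne hk, if_pos rfl, if_neg hk,
            zero_add, Gamma_half.2.1, one_mul]
        · rw [Pi.add_apply, Pi.single_eq_of_ne hk, Pi.single_eq_of_ne hkj, if_neg hk, if_neg hkj,
            add_zero, Gamma_half.1, one_mul, mul_one]
    simp only [h, Finset.prod_mul_distrib, Finset.prod_const, Finset.prod_ite_eq', if_neg hij]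
    norm_num

theorem integral_gaussian_diag (c : Fin d → ℝ) :
    ∫ x : EuclideanSpace ℝ (Fin d), (∑ i, c i * x i ^ 2) * exp (-‖x‖ ^ 2) =
      √π ^ d * (1 / 2 * ∑ i, c i) := by
  simp only [Finset.sum_mul, mul_assoc]
  rw [integral_finsetSum _ fun i _ => (gaussian_sq i).1.const_mul _]
  simp only [integral_const_mul, (gaussian_sq _).2, ← Finset.sum_mul]
  ring

theorem integral_gaussian_diag_sq (c : Fin d → ℝ) :
    ∫ x : EuclideanSpace ℝ (Fin d), (∑ i, c i * x i ^ 2) ^ 2 * exp (-‖x‖ ^ 2) =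
      √π ^ d * (1 / 4 * (2 * ∑ i, c i ^ 2 + (∑ i, c i) ^ 2)) := by
  have e : ∀ x : EuclideanSpace ℝ (Fin d), (∑ i, c i * x i ^ 2) ^ 2 * exp (-‖x‖ ^ 2) =
      ∑ i, ∑ j, (c i * c j) * ((x i ^ 2 * x j ^ 2) * exp (-‖x‖ ^ 2)) := by
    intro x
    rw [sq, Finset.sum_mul_sum, Finset.sum_mul]
    refine Finset.sum_congr rfl fun i _ => ?_
    rw [Finset.sum_mul]
    exact Finset.sum_congr rfl fun j _ => by ring
  simp only [e]
  rw [integral_finsetSum _ fun i _ => integrable_finsetSum _ fun j _ =>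
    (gaussian_sq_mul_sq i j).1.const_mul _]
  have e2 : ∀ i, ∫ x : EuclideanSpace ℝ (Fin d),
      ∑ j, (c i * c j) * ((x i ^ 2 * x j ^ 2) * exp (-‖x‖ ^ 2)) =
      √π ^ d * (1 / 4 * (2 * c i ^ 2 + c i * ∑ j, c j)) := by
    intro i
    rw [integral_finsetSum _ fun j _ => (gaussian_sq_mul_sq i j).1.const_mul _]
    simp only [integral_const_mul, (gaussian_sq_mul_sq _ _).2, mul_add, Finset.sum_add_distrib,
      mul_ite, mul_zero, Finset.sum_ite_eq, Finset.mem_univ, if_true, Finset.mul_sum]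
    rw [add_comm]
    congr 1
    · ring
    · exact Finset.sum_congr rfl fun j _ => by ring
  simp only [e2, ← Finset.mul_sum, Finset.sum_add_distrib, ← Finset.sum_mul]
  ring

variable {M : Matrix (Fin d) (Fin d) ℝ}

theorem Matrix.IsHermitian.dotProduct_mulVec_eq_sum (hM : M.IsHermitian)
    (x : EuclideanSpace ℝ (Fin d)) :
    x ⬝ᵥ (M *ᵥ x) = ∑ i, hM.eigenvalues i * hM.eigenvectorBasis.repr x i ^ 2 := by
  rw [← inner_toEuclideanCLM, ← hM.eigenvectorBasis.sum_inner_mul_inner]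
  refine Finset.sum_congr rfl fun i _ => ?_
  have h : inner ℝ (hM.eigenvectorBasis i) (toEuclideanCLM (𝕜 := ℝ) M x) =
      hM.eigenvalues i * inner ℝ (hM.eigenvectorBasis i) x := by
    rw [inner_toEuclideanCLM, dotProduct_mulVec, ← mulVec_transpose,
      show Mᵀ = M by simpa using hM.eq, hM.mulVec_eigenvectorBasis, smul_dotProduct, smul_eq_mul,
      EuclideanSpace.inner_eq_star_dotProduct, dotProduct_comm]
    simp
  rw [h, OrthonormalBasis.repr_apply_apply, real_inner_comm x]
  ring

theorem Matrix.IsHermitian.trace_mul_self_eq_sum (hM : M.IsHermitian) :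
    (M * M).trace = ∑ i, hM.eigenvalues i ^ 2 := by
  have h : M * M = Unitary.conjStarAlgAut ℝ _ hM.eigenvectorUnitary
      (diagonal fun i => hM.eigenvalues i ^ 2) := by
    conv_lhs => rw [hM.spectral_theorem, ← map_mul, diagonal_mul_diagonal]
    simp [sq]
  rw [h, Unitary.conjStarAlgAut_apply, trace_mul_cycle, Unitary.coe_star_mul_self, one_mul,
    trace_diagonal]

theorem integral_gaussian_quadratic (hM : M.IsHermitian) :
    ∫ x : EuclideanSpace ℝ (Fin d), (x ⬝ᵥ (M *ᵥ x)) * exp (-‖x‖ ^ 2) =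
      √π ^ d * (1 / 2 * M.trace) := by
  have htr : M.trace = ∑ i, hM.eigenvalues i := by simpa using hM.trace_eq_sum_eigenvalues
  rw [htr, ← integral_gaussian_diag]
  have h := hM.eigenvectorBasis.measurePreserving_repr.integral_comp
    hM.eigenvectorBasis.repr.toHomeomorph.measurableEmbedding
    (fun y => (∑ i, hM.eigenvalues i * y i ^ 2) * exp (-‖y‖ ^ 2))
  simp only [LinearIsometryEquiv.norm_map] at h
  simp only [hM.dotProduct_mulVec_eq_sum, h]

theorem integral_gaussian_quadratic_sq (hM : M.IsHermitian) :
    ∫ x : EuclideanSpace ℝ (Fin d), (x ⬝ᵥ (M *ᵥ x)) ^ 2 * exp (-‖x‖ ^ 2) =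
      √π ^ d * (1 / 4 * (2 * (M * M).trace + M.trace ^ 2)) := by
  have htr : M.trace = ∑ i, hM.eigenvalues i := by simpa using hM.trace_eq_sum_eigenvalues
  rw [htr, hM.trace_mul_self_eq_sum, ← integral_gaussian_diag_sq]
  have h := hM.eigenvectorBasis.measurePreserving_repr.integral_comp
    hM.eigenvectorBasis.repr.toHomeomorph.measurableEmbedding
    (fun y => (∑ i, hM.eigenvalues i * y i ^ 2) ^ 2 * exp (-‖y‖ ^ 2))
  simp only [LinearIsometryEquiv.norm_map] at h
  simp only [hM.dotProduct_mulVec_eq_sum, h]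

/-- The surface area of the unit sphere of `ℝ^d`. -/
noncomputable def sphereArea (d : ℕ) : ℝ := 2 * √π ^ d / Gamma (d / 2)

theorem integral_sphere_mul_Gamma (hd : 1 ≤ d) (h : EuclideanSpace ℝ (Fin d) → ℝ) (k : ℕ)
    (hh : ∀ (r : ℝ) (x : EuclideanSpace ℝ (Fin d)), h (r • x) = r ^ k * h x) :
    ∫ x, h x * exp (-‖x‖ ^ 2) =
      (∫ ω : Metric.sphere (0 : EuclideanSpace ℝ (Fin d)) 1, h ω ∂volume.toSphere) *
        (Gamma ((d + k) / 2) / 2) := by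
  have : Nonempty (Fin d) := ⟨⟨0, hd⟩⟩
  rw [integral_homogeneous_mul volume h k (fun r => exp (-r ^ 2)) hh]
  congr 1
  simp only [← mul_assoc, ← pow_add, integral_Ioi_pow_mul_exp_neg_sq, finrank_euclideanSpace,
    Fintype.card_fin]
  push_cast [hd]
  ring_nf

theorem integral_sphere_one (hd : 1 ≤ d) :
    ∫ _ω : Metric.sphere (0 : EuclideanSpace ℝ (Fin d)) 1, (1 : ℝ) ∂volume.toSphere =
      sphereArea d := by
  have h := integral_sphere_mul_Gamma hd (fun _ => 1) 0 (by simp)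
  have hG : 0 < Gamma ((d : ℝ) / 2) := Gamma_pos_of_pos (by positivity)
  simp only [one_mul, integral_exp_neg_norm_sq, Nat.cast_zero, add_zero] at h
  rw [sphereArea, h]
  field_simp

theorem integral_sphere_quadratic (hd : 1 ≤ d) (hM : M.IsHermitian) :
    ∫ ω : Metric.sphere (0 : EuclideanSpace ℝ (Fin d)) 1,
      ((ω : EuclideanSpace ℝ (Fin d)) ⬝ᵥ (M *ᵥ (ω : EuclideanSpace ℝ (Fin d)))) ∂volume.toSphere =
      sphereArea d * (M.trace / d) := by
  have h := integral_sphere_mul_Gamma hd (fun x => x ⬝ᵥ (M *ᵥ x)) 2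
    (by intro r x; simp [mulVec_smul]; ring)
  have hd' : (0 : ℝ) < d := by positivity
  have hG : 0 < Gamma ((d : ℝ) / 2) := Gamma_pos_of_pos (by positivity)
  rw [integral_gaussian_quadratic hM, show ((d : ℝ) + (2 : ℕ)) / 2 = d / 2 + 1 by push_cast; ring,
    Gamma_add_one (by positivity)] at h
  rw [sphereArea]
  field_simp
  field_simp at h
  linarith

theorem integral_sphere_quadratic_sq (hd : 1 ≤ d) (hM : M.IsHermitian) :
    ∫ ω : Metric.sphere (0 : EuclideanSpace ℝ (Fin d)) 1,
      ((ω : EuclideanSpace ℝ (Fin d)) ⬝ᵥ (M *ᵥ (ω : EuclideanSpace ℝ (Fin d)))) ^ 2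
        ∂volume.toSphere =
      sphereArea d * ((2 * (M * M).trace + M.trace ^ 2) / (d * (d + 2))) := by
  have h := integral_sphere_mul_Gamma hd (fun x => (x ⬝ᵥ (M *ᵥ x)) ^ 2) 4
    (by intro r x; simp [mulVec_smul]; ring)
  have hd' : (0 : ℝ) < d := by positivity
  have hG : 0 < Gamma ((d : ℝ) / 2) := Gamma_pos_of_pos (by positivity)
  rw [integral_gaussian_quadratic_sq hM,
    show ((d : ℝ) + (4 : ℕ)) / 2 = (d / 2 + 1) + 1 by push_cast; ring,
    Gamma_add_one (by positivity), Gamma_add_one (by positivity)] at h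
  rw [sphereArea]
  field_simp
  field_simp at h
  linarith

end Gaussian

section Expansion
variable {d m : ℕ} (M : Fin m → Matrix (Fin d) (Fin d) ℝ)

/-- The sum `∑ₖ ‖Mₖ x‖²` (for symmetric `Mₖ`), written as a quadratic form. -/
noncomputable def sumNormSq (x : Fin d → ℝ) : ℝ := ∑ k, x ⬝ᵥ ((M k * M k) *ᵥ x)

/-- The sum `∑ⱼ Qⱼ(x)²`. -/
noncomputable def sumFormSq (x : Fin d → ℝ) : ℝ := ∑ j, (x ⬝ᵥ (M j *ᵥ x)) ^ 2

theorem Lam_nonneg_s12 : 0 ≤ Lam M := iSup_nonneg fun _ => norm_nonneg _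

theorem norm_le_Lam (j : Fin m) : ‖toEuclideanCLM (𝕜 := ℝ) (M j)‖ ≤ Lam M :=
  le_ciSup (f := fun j => ‖toEuclideanCLM (𝕜 := ℝ) (M j)‖) (Set.finite_range _).bddAbove j

theorem norm_apply_le (j : Fin m) (x : EuclideanSpace ℝ (Fin d)) :
    ‖toEuclideanCLM (𝕜 := ℝ) (M j) x‖ ≤ Lam M * ‖x‖ :=
  (ContinuousLinearMap.le_opNorm _ _).trans
    (mul_le_mul_of_nonneg_right (norm_le_Lam M j) (norm_nonneg _))

theorem sumFormSq_nonneg (x : Fin d → ℝ) : 0 ≤ sumFormSq M x :=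
  Finset.sum_nonneg fun _ _ => sq_nonneg _

theorem sumFormSq_le {x : EuclideanSpace ℝ (Fin d)} (hx : ‖x‖ ≤ 1) :
    sumFormSq M x ≤ m * Lam M ^ 2 := by
  have h : ∀ j ∈ Finset.univ, ((x : Fin d → ℝ) ⬝ᵥ (M j *ᵥ x)) ^ 2 ≤ Lam M ^ 2 := by
    intro j _
    rw [← inner_toEuclideanCLM, sq_le_sq, abs_of_nonneg (Lam_nonneg_s12 M)]
    refine (abs_real_inner_le_norm _ _).trans ?_
    calc _ ≤ 1 * (Lam M * 1) := by
          refine mul_le_mul hx ((norm_apply_le M j x).trans ?_) (norm_nonneg _) zero_le_one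
          exact mul_le_mul_of_nonneg_left hx (Lam_nonneg_s12 M)
      _ = Lam M := by ring
  simpa [sumFormSq] using Finset.sum_le_card_nsmul _ _ _ h

variable {M}

theorem dotProduct_mul_self_mulVec {N : Matrix (Fin d) (Fin d) ℝ} (hN : N.IsSymm) (x : Fin d → ℝ) :
    x ⬝ᵥ ((N * N) *ᵥ x) = (N *ᵥ x) ⬝ᵥ (N *ᵥ x) := by
  rw [← mulVec_mulVec, dotProduct_mulVec, ← mulVec_transpose, hN.eq]

theorem sumNormSq_nonneg (hM : ∀ j, (M j).IsSymm) (x : Fin d → ℝ) : 0 ≤ sumNormSq M x :=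
  Finset.sum_nonneg fun k _ => by
    rw [dotProduct_mul_self_mulVec (hM k)]
    exact Finset.sum_nonneg fun _ _ => mul_self_nonneg _

theorem sumNormSq_le (hM : ∀ j, (M j).IsSymm) {x : EuclideanSpace ℝ (Fin d)} (hx : ‖x‖ ≤ 1) :
    sumNormSq M x ≤ m * Lam M ^ 2 := by
  have h : ∀ j ∈ Finset.univ, (x : Fin d → ℝ) ⬝ᵥ ((M j * M j) *ᵥ x) ≤ Lam M ^ 2 := by
    intro j _
    have e : (x : Fin d → ℝ) ⬝ᵥ ((M j * M j) *ᵥ x) = ‖toEuclideanCLM (𝕜 := ℝ) (M j) x‖ ^ 2 := by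
      rw [dotProduct_mul_self_mulVec (hM j), EuclideanSpace.real_norm_sq_eq]
      simp [dotProduct, sq]
    rw [e]
    have := norm_apply_le M j x
    have h2 : Lam M * ‖x‖ ≤ Lam M * 1 := mul_le_mul_of_nonneg_left hx (Lam_nonneg_s12 M)
    exact pow_le_pow_left₀ (norm_nonneg _) (by linarith) 2
  simpa [sumNormSq] using Finset.sum_le_card_nsmul _ _ _ h

theorem gMat_det_bounds (hM : ∀ j, (M j).IsSymm) (x : Fin d → ℝ) :
    1 + 4 * sumNormSq M x ≤ (gMat M x).det ∧ (gMat M x).det ≤ exp (4 * sumNormSq M x) := by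
  have hP : ((4 : ℝ) • ∑ k, vecMulVec (M k *ᵥ x) (M k *ᵥ x)).PosSemidef := by
    refine PosSemidef.smul (posSemidef_sum _ fun k _ => ?_) (by norm_num)
    simpa using posSemidef_vecMulVec_self_star (M k *ᵥ x)
  have htr : ((4 : ℝ) • ∑ k, vecMulVec (M k *ᵥ x) (M k *ᵥ x)).trace = 4 * sumNormSq M x := by
    simp only [trace_smul, trace_sum, trace_vecMulVec, sumNormSq, smul_eq_mul,
      dotProduct_mul_self_mulVec (hM _)]
  rw [← htr]
  exact hP.det_one_add_bounds

theorem abs_Sdens_sub_le (hM : ∀ j, (M j).IsSymm) (hL : Lam M ≤ 1)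
    {x : EuclideanSpace ℝ (Fin d)} (hx : ‖x‖ ≤ 1) :
    |Sdens M x - (1 + 2 * sumNormSq M x)| ≤ 4 * exp (2 * m) * m ^ 2 * Lam M ^ 4 := by
  have hp := sumNormSq_nonneg hM x
  have hp' := sumNormSq_le hM hx
  have hL0 := Lam_nonneg_s12 M
  have hK : sumNormSq M x ≤ m := hp'.trans
    (mul_le_of_le_one_right m.cast_nonneg (pow_le_one₀ hL0 hL))
  obtain ⟨h1, h2⟩ := gMat_det_bounds hM x
  refine (abs_sqrt_sub_one_sub_le hp hK h1 h2).trans ?_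
  calc _ ≤ 4 * exp (2 * m) * (m * Lam M ^ 2) ^ 2 := by gcongr
    _ = _ := by ring

variable (M)

theorem continuous_sumNormSq : Continuous (sumNormSq M) := by
  unfold sumNormSq; fun_prop

theorem continuous_sumFormSq : Continuous (sumFormSq M) := by
  unfold sumFormSq; fun_prop

theorem continuous_Sdens_s12 : Continuous (Sdens M) := by
  unfold Sdens gMat
  refine continuous_sqrt.comp (Continuous.matrix_det ?_)
  have h : Continuous fun x : Fin d → ℝ => ∑ k, vecMulVec (M k *ᵥ x) (M k *ᵥ x) :=
    continuous_finsetSum _ fun k _ => Continuous.matrix_vecMulVec (by fun_prop) (by fun_prop)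
  fun_prop

/-- The region `R`, as a subset of Euclidean space. -/
def euclideanRegion : Set (EuclideanSpace ℝ (Fin d)) := {x | ‖x‖ ^ 2 + sumFormSq M x ≤ 1}

theorem euclideanRegion_eq : euclideanRegion M = WithLp.ofLp ⁻¹' regionR M := by
  ext x
  simp only [euclideanRegion, regionR, Set.mem_ofPred_eq, Set.mem_preimage,
    EuclideanSpace.real_norm_sq_eq, sumFormSq]

theorem norm_le_one_of_mem_euclideanRegion {x : EuclideanSpace ℝ (Fin d)}
    (hx : x ∈ euclideanRegion M) : ‖x‖ ≤ 1 := by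
  have h : ‖x‖ ^ 2 + sumFormSq M x ≤ 1 := hx
  have := sumFormSq_nonneg M x
  nlinarith [norm_nonneg x]

theorem isCompact_euclideanRegion : IsCompact (euclideanRegion M) := by
  refine (isCompact_closedBall (0 : EuclideanSpace ℝ (Fin d)) 1).of_isClosed_subset ?_
    fun x hx => by simpa using norm_le_one_of_mem_euclideanRegion M hx
  have := (continuous_sumFormSq M).comp (PiLp.continuous_ofLp 2 fun _ : Fin d => ℝ)
  exact isClosed_le ((continuous_norm.pow 2).add this) continuous_const

theorem integrableOn_norm_sq_mul {f : (Fin d → ℝ) → ℝ} (hf : Continuous f) :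
    IntegrableOn (fun x : EuclideanSpace ℝ (Fin d) => ‖x‖ ^ 2 * f x) (euclideanRegion M) := by
  have := hf.comp (PiLp.continuous_ofLp 2 fun _ : Fin d => ℝ)
  exact ContinuousOn.integrableOn_compact (isCompact_euclideanRegion M)
    ((continuous_norm.pow 2).mul this).continuousOn

theorem integrableOn_norm_sq_mul_one_add :
    IntegrableOn (fun x : EuclideanSpace ℝ (Fin d) => ‖x‖ ^ 2 * (1 + 2 * sumNormSq M x))
      (euclideanRegion M) := by
  have h := continuous_sumNormSq M
  exact integrableOn_norm_sq_mul M (f := fun x => 1 + 2 * sumNormSq M x) (by fun_prop)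

theorem sum_setIntegral_regionR :
    ∑ i, ∫ x in regionR M, x i ^ 2 * Sdens M x =
      ∫ x in euclideanRegion M, ‖x‖ ^ 2 * Sdens M x := by
  have hS := (continuous_Sdens_s12 M).comp (PiLp.continuous_ofLp 2 fun _ : Fin d => ℝ)
  have e : ∀ i, ∫ x in regionR M, x i ^ 2 * Sdens M x =
      ∫ x in euclideanRegion M, x i ^ 2 * Sdens M x := by
    intro i
    rw [euclideanRegion_eq]
    exact ((PiLp.volume_preserving_ofLp (Fin d)).setIntegral_preimage_emb
      (MeasurableEquiv.toLp 2 _).symm.measurableEmbedding (fun x => x i ^ 2 * Sdens M x) _).symm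
  simp only [e]
  rw [← integral_finsetSum]
  · simp only [EuclideanSpace.real_norm_sq_eq, Finset.sum_mul]
  · intro i _
    refine ContinuousOn.integrableOn_compact (isCompact_euclideanRegion M)
      (Continuous.continuousOn ?_)
    exact ((by fun_prop : Continuous fun x : EuclideanSpace ℝ (Fin d) => x i ^ 2)).mul hS

variable {M}

theorem abs_setIntegral_sub_le (hM : ∀ j, (M j).IsSymm) (hL : Lam M ≤ 1) :
    |(∫ x in euclideanRegion M, ‖x‖ ^ 2 * Sdens M x) -
      ∫ x in euclideanRegion M, ‖x‖ ^ 2 * (1 + 2 * sumNormSq M x)| ≤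
      4 * exp (2 * m) * m ^ 2 * Lam M ^ 4 *
        volume.real (Metric.closedBall (0 : EuclideanSpace ℝ (Fin d)) 1) := by
  have hc := isCompact_euclideanRegion M
  rw [← integral_sub (integrableOn_norm_sq_mul M (continuous_Sdens_s12 M))
    (integrableOn_norm_sq_mul_one_add M), ← norm_eq_abs]
  refine (norm_setIntegral_le_of_norm_le_const (C := 4 * exp (2 * m) * m ^ 2 * Lam M ^ 4)
    hc.measure_lt_top fun x hx => ?_).trans ?_
  · have hx1 := norm_le_one_of_mem_euclideanRegion M hx
    rw [← mul_sub, norm_mul, norm_eq_abs, norm_eq_abs, abs_of_nonneg (sq_nonneg _)]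
    refine (mul_le_of_le_one_left (abs_nonneg _) (pow_le_one₀ (norm_nonneg _) hx1)).trans ?_
    exact abs_Sdens_sub_le hM hL hx1
  · refine mul_le_mul_of_nonneg_left (measureReal_mono (fun x hx => ?_)
      (isCompact_closedBall _ _).measure_lt_top.ne) (by positivity)
    simpa using norm_le_one_of_mem_euclideanRegion M hx

theorem sumNormSq_smul (r : ℝ) (x : Fin d → ℝ) : sumNormSq M (r • x) = r ^ 2 * sumNormSq M x := by
  simp only [sumNormSq, mulVec_smul, smul_dotProduct, dotProduct_smul, smul_eq_mul, Finset.mul_sum]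
  exact Finset.sum_congr rfl fun _ _ => by ring

theorem sumFormSq_smul (r : ℝ) (x : Fin d → ℝ) : sumFormSq M (r • x) = r ^ 4 * sumFormSq M x := by
  simp only [sumFormSq, mulVec_smul, smul_dotProduct, dotProduct_smul, smul_eq_mul, Finset.mul_sum]
  exact Finset.sum_congr rfl fun _ _ => by ring

theorem abs_radial_integral_sub_le (hd : 1 ≤ d) {p q b : ℝ} (hp : 0 ≤ p) (hq : 0 ≤ q) (hpb : p ≤ b)
    (hqb : q ≤ b) :
    |(∫ r in Set.Ioi (0 : ℝ), r ^ (d - 1) *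
      ({r : ℝ | r ^ 2 + r ^ 4 * q ≤ 1}.indicator (fun r => r ^ 2 * (1 + 2 * (r ^ 2 * p))) r)) -
      (1 / (d + 2) - q / 2 + 2 / (d + 4) * p)| ≤ (d + 6 + 2 * (d + 7) * b) * b ^ 2 := by
  obtain ⟨s, hs, h⟩ := exists_pos_sq_add_eq_one hq
  have hb : 0 ≤ b := hp.trans hpb
  have h2 := abs_pow_sub_le_of_sq_add hs hq h (d + 2)
  have h4 := abs_pow_sub_le_of_sq_add hs hq h (d + 4)
  rw [integral_Ioi_indicator_pow hs hq h, show d - 1 + 3 = d + 2 by omega,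
    show d - 1 + 5 = d + 4 by omega]
  push_cast [hd] at h2 h4 ⊢
  set u := s ^ (d + 2) - (1 - (d + 2) / 2 * q) with hu
  set v := s ^ (d + 4) - (1 - (d + 4) / 2 * q) with hv
  have e : s ^ (d + 2) / ((d : ℝ) - 1 + 3) + 2 * p * (s ^ (d + 4) / ((d : ℝ) - 1 + 5)) -
      (1 / (d + 2) - q / 2 + 2 / (d + 4) * p) = u / (d + 2) + 2 * p * (v / (d + 4)) - p * q := by
    rw [hu, hv, show (d : ℝ) - 1 + 3 = d + 2 by ring, show (d : ℝ) - 1 + 5 = d + 4 by ring]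
    field_simp
    ring
  have hu' : |u / (d + 2)| ≤ (d + 5) * q ^ 2 := by
    rw [abs_div, abs_of_pos (by positivity : (0 : ℝ) < d + 2), div_le_iff₀ (by positivity)]
    linarith
  have hv' : |v / (d + 4)| ≤ (d + 7) * q ^ 2 := by
    rw [abs_div, abs_of_pos (by positivity : (0 : ℝ) < d + 4), div_le_iff₀ (by positivity)]
    linarith
  rw [e]
  calc |u / (d + 2) + 2 * p * (v / (d + 4)) - p * q|
      ≤ |u / (d + 2)| + |2 * p * (v / (d + 4))| + |p * q| :=
        (abs_sub _ _).trans (add_le_add_left (abs_add_le _ _) _)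
    _ = |u / (d + 2)| + 2 * p * |v / (d + 4)| + p * q := by
        rw [abs_mul (2 * p), abs_of_nonneg (by positivity : 0 ≤ 2 * p),
          abs_of_nonneg (by positivity : 0 ≤ p * q)]
    _ ≤ (d + 5) * b ^ 2 + 2 * b * ((d + 7) * b ^ 2) + b * b := by
        gcongr
        · exact hu'.trans (by gcongr)
        · exact hv'.trans (by gcongr)
    _ = _ := by ring

theorem integral_sphere_expansion (hd : 1 ≤ d) (hM : ∀ j, (M j).IsSymm) :
    Integrable (fun ω : Metric.sphere (0 : EuclideanSpace ℝ (Fin d)) 1 =>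
      1 / ((d : ℝ) + 2) - sumFormSq M (ω : EuclideanSpace ℝ (Fin d)) / 2 +
        2 / (d + 4) * sumNormSq M (ω : EuclideanSpace ℝ (Fin d))) volume.toSphere ∧
    ∫ ω : Metric.sphere (0 : EuclideanSpace ℝ (Fin d)) 1,
      (1 / ((d : ℝ) + 2) - sumFormSq M (ω : EuclideanSpace ℝ (Fin d)) / 2 +
        2 / (d + 4) * sumNormSq M (ω : EuclideanSpace ℝ (Fin d))) ∂volume.toSphere =
      sphereArea d * (1 / (d + 2) - (2 * Aconst M + Bconst M) / (d * (d + 2)) / 2 +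
        2 / (d + 4) * (Aconst M / d)) := by
  have hint : ∀ f : (Fin d → ℝ) → ℝ, Continuous f → Integrable
      (fun ω : Metric.sphere (0 : EuclideanSpace ℝ (Fin d)) 1 =>
        f (ω : EuclideanSpace ℝ (Fin d))) volume.toSphere := fun f hf =>
    Continuous.integrable_of_hasCompactSupport
      (hf.comp ((PiLp.continuous_ofLp 2 fun _ : Fin d => ℝ).comp continuous_subtype_val))
      (HasCompactSupport.of_compactSpace _)
  have hH : ∀ j, (M j).IsHermitian := fun j => by simpa [IsHermitian] using (hM j).eq
  have hH2 : ∀ j, (M j * M j).IsHermitian := fun j => by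
    simp [IsHermitian, conjTranspose_eq_transpose_of_trivial, (hM j).eq]
  have h1 := hint (fun _ => 1 / ((d : ℝ) + 2)) continuous_const
  have h2 := (hint _ (continuous_sumFormSq M)).div_const 2
  have h3 := (hint _ (continuous_sumNormSq M)).const_mul (2 / ((d : ℝ) + 4))
  refine ⟨(h1.sub h2).add h3, ?_⟩
  have e1 : ∫ ω : Metric.sphere (0 : EuclideanSpace ℝ (Fin d)) 1, (1 / ((d : ℝ) + 2))
      ∂volume.toSphere = sphereArea d * (1 / (d + 2)) := by
    rw [← integral_sphere_one hd, ← integral_mul_const]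
    simp
  have e2 : ∫ ω : Metric.sphere (0 : EuclideanSpace ℝ (Fin d)) 1,
      sumFormSq M (ω : EuclideanSpace ℝ (Fin d)) ∂volume.toSphere =
      sphereArea d * ((2 * Aconst M + Bconst M) / (d * (d + 2))) := by
    simp only [sumFormSq]
    rw [integral_finsetSum _ fun j _ => hint (fun x => (x ⬝ᵥ (M j *ᵥ x)) ^ 2) (by fun_prop)]
    simp only [integral_sphere_quadratic_sq hd (hH _), ← Finset.mul_sum, ← Finset.sum_div,
      Finset.sum_add_distrib, Aconst, Bconst]
  have e3 : ∫ ω : Metric.sphere (0 : EuclideanSpace ℝ (Fin d)) 1,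
      sumNormSq M (ω : EuclideanSpace ℝ (Fin d)) ∂volume.toSphere =
      sphereArea d * (Aconst M / d) := by
    simp only [sumNormSq]
    rw [integral_finsetSum _ fun j _ => hint (fun x => x ⬝ᵥ ((M j * M j) *ᵥ x)) (by fun_prop)]
    simp only [integral_sphere_quadratic hd (hH2 _), ← Finset.mul_sum, ← Finset.sum_div, Aconst]
  have h12 : Integrable (fun ω : Metric.sphere (0 : EuclideanSpace ℝ (Fin d)) 1 =>
      1 / ((d : ℝ) + 2) - sumFormSq M (ω : EuclideanSpace ℝ (Fin d)) / 2) volume.toSphere :=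
    h1.sub h2
  rw [integral_add h12 h3, integral_sub h1 h2, e1, integral_div, integral_const_mul, e2, e3]
  ring

theorem abs_setIntegral_euclideanRegion_sub_le (hd : 1 ≤ d) (hM : ∀ j, (M j).IsSymm)
    (hL : Lam M ≤ 1) :
    |(∫ x in euclideanRegion M, ‖x‖ ^ 2 * (1 + 2 * sumNormSq M x)) -
      sphereArea d * (1 / (d + 2) - (2 * Aconst M + Bconst M) / (d * (d + 2)) / 2 +
        2 / (d + 4) * (Aconst M / d))| ≤
      (d + 6 + 2 * (d + 7) * m) * m ^ 2 * Lam M ^ 4 *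
        (volume : Measure (EuclideanSpace ℝ (Fin d))).toSphere.real Set.univ := by
  have : Nonempty (Fin d) := ⟨⟨0, hd⟩⟩
  have hc := isCompact_euclideanRegion M
  obtain ⟨hi, he⟩ := integral_polar volume
    ((integrableOn_norm_sq_mul_one_add M).integrable_indicator hc.measurableSet)
  obtain ⟨hi', he'⟩ := integral_sphere_expansion hd hM
  rw [← integral_indicator hc.measurableSet, he, ← he', ← integral_sub hi hi', ← norm_eq_abs]
  refine norm_integral_le_of_norm_le_const (.of_forall fun ω => ?_)
  have hω : ‖(ω : EuclideanSpace ℝ (Fin d))‖ = 1 := by simp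
  have e : ∀ r ∈ Set.Ioi (0 : ℝ), r ^ (Module.finrank ℝ (EuclideanSpace ℝ (Fin d)) - 1) *
      (euclideanRegion M).indicator (fun x : EuclideanSpace ℝ (Fin d) =>
        ‖x‖ ^ 2 * (1 + 2 * sumNormSq M x)) (r • (ω : EuclideanSpace ℝ (Fin d))) =
      r ^ (d - 1) * ({r : ℝ |
          r ^ 2 + r ^ 4 * sumFormSq M (ω : EuclideanSpace ℝ (Fin d)) ≤ 1}.indicator
        (fun r => r ^ 2 * (1 + 2 * (r ^ 2 * sumNormSq M (ω : EuclideanSpace ℝ (Fin d))))) r) := by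
    intro r hr
    have hr : (0 : ℝ) < r := hr
    simp only [Set.indicator_apply, euclideanRegion, Set.mem_ofPred_eq, norm_smul, hω,
      norm_of_nonneg hr.le, mul_one, WithLp.ofLp_smul, sumNormSq_smul, sumFormSq_smul,
      finrank_euclideanSpace, Fintype.card_fin]
  rw [setIntegral_congr_fun measurableSet_Ioi e, norm_eq_abs]
  have hL0 := Lam_nonneg_s12 M
  refine (abs_radial_integral_sub_le hd (sumNormSq_nonneg hM _) (sumFormSq_nonneg M _)
    (sumNormSq_le hM hω.le) (sumFormSq_le M hω.le)).trans ?_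
  have hb : (m : ℝ) * Lam M ^ 2 ≤ m :=
    mul_le_of_le_one_right m.cast_nonneg (pow_le_one₀ hL0 hL)
  calc _ ≤ (d + 6 + 2 * (d + 7) * (m : ℝ)) * (m * Lam M ^ 2) ^ 2 := by gcongr
    _ = _ := by ring

end Expansion

theorem stmt12 (d D : ℕ) (hd : 1 ≤ d) (hD : d < D) :
    ∃ C > 0, ∀ M : Fin (D - d) → Matrix (Fin d) (Fin d) ℝ,
      (∀ j, (M j).IsSymm) → Lam M ≤ 1 →
      |(∑ i, ∫ x in regionR M, x i ^ 2 * Sdens M x) -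
          Real.pi ^ ((d : ℝ) / 2) / Real.Gamma ((d : ℝ) / 2) *
            (2 / ((d : ℝ) + 2) - Bconst M / ((d : ℝ) * ((d : ℝ) + 2)) +
              2 * Aconst M / (((d : ℝ) + 2) * ((d : ℝ) + 4)))|
        ≤ C * Lam M ^ 4 := by
  set m := D - d
  refine ⟨4 * exp (2 * m) * m ^ 2 *
      volume.real (Metric.closedBall (0 : EuclideanSpace ℝ (Fin d)) 1) +
    (d + 6 + 2 * (d + 7) * m) * m ^ 2 *
      (volume : Measure (EuclideanSpace ℝ (Fin d))).toSphere.real Set.univ + 1, by positivity,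
    fun M hM hL => ?_⟩
  have hd' : (0 : ℝ) < d := by positivity
  have hpi : √π ^ d = π ^ ((d : ℝ) / 2) := by
    rw [sqrt_eq_rpow, ← rpow_natCast, ← rpow_mul pi_pos.le]
    ring_nf
  have hmain : π ^ ((d : ℝ) / 2) / Gamma ((d : ℝ) / 2) *
      (2 / ((d : ℝ) + 2) - Bconst M / ((d : ℝ) * ((d : ℝ) + 2)) +
        2 * Aconst M / (((d : ℝ) + 2) * ((d : ℝ) + 4))) =
      sphereArea d * (1 / (d + 2) - (2 * Aconst M + Bconst M) / (d * (d + 2)) / 2 +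
        2 / (d + 4) * (Aconst M / d)) := by
    have hG : 0 < Gamma ((d : ℝ) / 2) := Gamma_pos_of_pos (by positivity)
    rw [sphereArea, hpi]
    field_simp
    ring
  rw [hmain, sum_setIntegral_regionR]
  refine (abs_sub_le _ _ _).trans ((add_le_add (abs_setIntegral_sub_le hM hL)
    (abs_setIntegral_euclideanRegion_sub_le hd hM hL)).trans ?_)
  linarith [pow_nonneg (Lam_nonneg_s12 M) 4]
end
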